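/- Let Γ be a group in which the intersection of all maximal nilpotent subgroups is the trivial subgroup, and let G be a nilpotent group. Then the subgroup {1} × G of Γ × G is characteristic: every automorphism f of Γ × G maps {1} × G onto {1} × G. -/

import Mathlib

/-- A subgroup is maximal nilpotent if it is nilpotent and maximal (w.r.t. inclusion)
among nilpotent subgroups. -/
def IsMaximalNilpotentSubgroup {G : Type*} [Group G] (H : Subgroup G) : Prop :=
  Group.IsNilpotent H ∧ ∀ K : Subgroup G, Group.IsNilpotent K → H ≤ K → K = H

theorem Subgroup.isNilpotent_prod {Γ G : Type*} [Group Γ] [Group G]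
    (H : Subgroup Γ) (K : Subgroup G) (hH : Group.IsNilpotent H) (hK : Group.IsNilpotent K) :
    Group.IsNilpotent (H.prod K) :=
  Group.nilpotent_of_mulEquiv (H.prodEquiv K).symm

theorem Subgroup.isNilpotent_map {A B : Type*} [Group A] [Group B] (f : A →* B)
    (H : Subgroup A) (hH : Group.IsNilpotent H) : Group.IsNilpotent (H.map f) :=
  Group.nilpotent_of_surjective (f.subgroupMap H) (f.subgroupMap_surjective H)

/-- Automorphisms carry maximal nilpotent subgroups to maximal nilpotent subgroups. -/
theorem IsMaximalNilpotentSubgroup.map_mulEquiv {A B : Type*} [Group A] [Group B] (f : A ≃* B)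
    {H : Subgroup A} (hH : IsMaximalNilpotentSubgroup H) :
    IsMaximalNilpotentSubgroup (H.map f.toMonoidHom) := by
  refine ⟨H.isNilpotent_map _ hH.1, fun K hK hle => ?_⟩
  have h := hH.2 (K.map f.symm.toMonoidHom) (K.isNilpotent_map _ hK) fun x hx =>
    ⟨f x, hle ⟨x, hx, rfl⟩, f.symm_apply_apply x⟩
  rw [← h]
  ext x
  simp [Subgroup.mem_map]

theorem IsMaximalNilpotentSubgroup.prod_top {Γ G : Type*} [Group Γ] [Group G]
    [Group.IsNilpotent G] {H : Subgroup Γ} (hH : IsMaximalNilpotentSubgroup H) :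
    IsMaximalNilpotentSubgroup (H.prod (⊤ : Subgroup G)) := by
  refine ⟨H.isNilpotent_prod ⊤ hH.1 inferInstance, fun K hK hle => le_antisymm ?_ hle⟩
  have h := hH.2 (K.map (MonoidHom.fst Γ G)) (K.isNilpotent_map _ hK) fun x hx =>
    ⟨(x, 1), hle ⟨hx, trivial⟩, rfl⟩
  exact fun x hx => ⟨h ▸ Subgroup.mem_map_of_mem (MonoidHom.fst Γ G) hx, trivial⟩

theorem IsMaximalNilpotentSubgroup.eq_prod_top {Γ G : Type*} [Group Γ] [Group G]
    [Group.IsNilpotent G] {K : Subgroup (Γ × G)} (hK : IsMaximalNilpotentSubgroup K) :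
    ∃ H : Subgroup Γ, IsMaximalNilpotentSubgroup H ∧ K = H.prod ⊤ := by
  have key : ∀ L : Subgroup Γ, Group.IsNilpotent L → K.map (MonoidHom.fst Γ G) ≤ L →
      L.prod ⊤ = K := fun L hL hle =>
    hK.2 _ (L.isNilpotent_prod ⊤ hL inferInstance) fun x hx =>
      ⟨hle (Subgroup.mem_map_of_mem (MonoidHom.fst Γ G) hx), trivial⟩
  have hn := K.isNilpotent_map (MonoidHom.fst Γ G) hK.1
  refine ⟨_, ⟨hn, fun L hL hle => le_antisymm (fun x hx => ?_) hle⟩, (key _ hn le_rfl).symm⟩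
  have hx' : ((x, 1) : Γ × G) ∈ K := key L hL hle ▸ ⟨hx, trivial⟩
  exact ⟨(x, 1), hx', rfl⟩

/-- The intersection of the maximal nilpotent subgroups of `Γ × G`, for nilpotent `G`. -/
theorem sInf_isMaximalNilpotentSubgroup_prod (Γ G : Type*) [Group Γ] [Group G]
    [Group.IsNilpotent G] :
    sInf {K : Subgroup (Γ × G) | IsMaximalNilpotentSubgroup K} =
      (sInf {H : Subgroup Γ | IsMaximalNilpotentSubgroup H}).prod ⊤ := by
  ext x
  simp only [Subgroup.mem_prod, Subgroup.mem_sInf, Set.mem_ofPred_eq, Subgroup.mem_top, and_true]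
  constructor
  · exact fun h H hH => (h _ hH.prod_top).1
  · intro h K hK
    obtain ⟨H, hH, rfl⟩ := hK.eq_prod_top
    exact ⟨h H hH, trivial⟩

/-- The intersection of the maximal nilpotent subgroups is characteristic. -/
theorem characteristic_sInf_isMaximalNilpotentSubgroup (A : Type*) [Group A] :
    (sInf {K : Subgroup A | IsMaximalNilpotentSubgroup K}).Characteristic := by
  refine Subgroup.characteristic_iff_le_comap.mpr fun f x hx => ?_
  refine Subgroup.mem_sInf.mpr fun K hK => ?_
  obtain ⟨y, hy, hyx⟩ := Subgroup.mem_sInf.mp hx _ (hK.map_mulEquiv f.symm)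
  have hfx : f x = y := by
    rw [← hyx]
    exact f.apply_symm_apply y
  exact hfx ▸ hy


/-- If the intersection of all maximal nilpotent subgroups of `Γ` is trivial and `G` is
nilpotent, then the subgroup `{1} × G` of `Γ × G` is characteristic: every automorphism
of `Γ × G` maps it onto itself. -/
theorem stmt_3 (Γ G : Type*) [Group Γ] [Group G] [Group.IsNilpotent G]
    (hΓ : sInf {H : Subgroup Γ | IsMaximalNilpotentSubgroup H} = ⊥) :
    ∀ f : MulAut (Γ × G),
      ((⊥ : Subgroup Γ).prod (⊤ : Subgroup G)).map (f : Γ × G →* Γ × G)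
        = (⊥ : Subgroup Γ).prod (⊤ : Subgroup G) := by
  intro f
  have h := characteristic_sInf_isMaximalNilpotentSubgroup (Γ × G)
  rw [sInf_isMaximalNilpotentSubgroup_prod, hΓ] at h
  exact Subgroup.characteristic_iff_map_eq.mp h f
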